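/- arXiv:1512.05003 — 3 statements merged into one kernel-verified Lean document; each statement's English description precedes it below -/
import Mathlib

section
/- Let p be a prime number, let B be a commutative ring of characteristic p, let A be a subring of B, and let e be a natural number such that b^(p^e) ∈ A for every b ∈ B. Then for every Witt vector x ∈ W(B), the element p^e • x lies in the image of the ring homomorphism W(A) → W(B) induced by the inclusion A ↪ B. (This is the key step in the proof that a finite universal homeomorphism induces an isomorphism on rational Witt vector cohomology.) -/
/-- A Witt vector all of whose coefficients lie in a subring comes from that subring. -/
theorem WittVector.mem_range_map_subtype_of_coeff_mem {p : ℕ} [Fact p.Prime] {B : Type*}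
    [CommRing B] {A : Subring B} {x : WittVector p B} (hx : ∀ n, x.coeff n ∈ A) :
    x ∈ (WittVector.map A.subtype : WittVector p A →+* WittVector p B).range :=
  ⟨WittVector.mk p fun n => ⟨x.coeff n, hx n⟩, by ext n; simp [WittVector.map_coeff]⟩

/-- Let `p` be a prime, `B` a commutative ring of characteristic `p`, `A` a subring of `B`,
and `e : ℕ` such that `b ^ p ^ e ∈ A` for every `b : B`.  Then for every Witt vector
`x ∈ W(B)`, the element `p ^ e • x` lies in the image of the ring homomorphism
`W(A) → W(B)` induced by the inclusion `A ↪ B`. -/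
theorem witt_pow_smul_mem_range_of_pow_mem
    (p : ℕ) [Fact p.Prime] (B : Type*) [CommRing B] [CharP B p]
    (A : Subring B) (e : ℕ) (h : ∀ b : B, b ^ p ^ e ∈ A)
    (x : WittVector p B) :
    p ^ e • x ∈ (WittVector.map A.subtype).range := by
  refine WittVector.mem_range_map_subtype_of_coeff_mem fun n => ?_
  rw [nsmul_eq_mul, mul_comm, Nat.cast_pow]
  obtain hn | hn := lt_or_ge n e
  · rw [WittVector.mul_pow_charP_coeff_zero x hn]
    exact A.zero_mem
  · obtain ⟨m, rfl⟩ := Nat.exists_eq_add_of_le' hn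
    rw [WittVector.mul_pow_charP_coeff_succ]
    exact h _
end

section
/- Let p be a prime number, let B be a commutative ring of characteristic p, let A be a subring of B, and let e be a natural number such that b^(p^e) ∈ A for every b ∈ B. Then the ring homomorphism W(A) ⊗_ℤ ℚ → W(B) ⊗_ℤ ℚ induced by the inclusion A ↪ B is bijective. (This is the algebraic core of the lemma that a finite universal homeomorphism f : X → Y induces an isomorphism W𝒪_{Y,ℚ} → f_* W𝒪_{X,ℚ}.) -/
open scoped TensorProduct

/-- If every `p ^ e`-th power of an element of `B` lies in `A`, then `p ^ e` times any Witt vector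
over `B` has coefficients in `A`. -/
theorem WittVector.mul_p_pow_mem_range_map (p : ℕ) [Fact p.Prime] {B : Type*} [CommRing B]
    [CharP B p] (A : Subring B) (e : ℕ) (h : ∀ b : B, b ^ p ^ e ∈ A) (w : WittVector p B) :
    ∃ y : WittVector p A, WittVector.map A.subtype y = w * (p : WittVector p B) ^ e := by
  let z : WittVector p A := WittVector.mk p fun n => ⟨w.coeff n ^ p ^ e, h _⟩
  have hz : WittVector.map A.subtype z = WittVector.frobenius^[e] w := by
    ext n
    simp [z, WittVector.map_coeff, WittVector.iterate_frobenius_coeff]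
  have hV : Function.Semiconj (WittVector.map A.subtype : WittVector p A → WittVector p B)
      WittVector.verschiebung WittVector.verschiebung :=
    fun x => WittVector.map_verschiebung _ x
  refine ⟨WittVector.verschiebung^[e] z, ?_⟩
  rw [(hV.iterate_right e).eq, hz, WittVector.iterate_verschiebung_iterate_frobenius]

/-- Let `p` be a prime, `B` a commutative ring of characteristic `p`, `A` a subring of `B`,
and `e : ℕ` such that `b ^ p ^ e ∈ A` for every `b : B`.  Then the ring homomorphism
`W(A) ⊗[ℤ] ℚ → W(B) ⊗[ℤ] ℚ` induced by the inclusion `A ↪ B` is bijective. -/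
theorem witt_tensor_rat_bijective_of_pow_mem
    (p : ℕ) [Fact p.Prime] (B : Type*) [CommRing B] [CharP B p]
    (A : Subring B) (e : ℕ) (h : ∀ b : B, b ^ p ^ e ∈ A) :
    Function.Bijective
      (Algebra.TensorProduct.map (WittVector.map A.subtype).toIntAlgHom (AlgHom.id ℤ ℚ) :
        WittVector p A ⊗[ℤ] ℚ →ₐ[ℤ] WittVector p B ⊗[ℤ] ℚ) := by
  constructor
  · exact Module.Flat.rTensor_preserves_injective_linearMap (M := ℚ)
      (WittVector.map A.subtype).toIntAlgHom.toLinearMap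
      (WittVector.map_injective A.subtype Subtype.val_injective)
  · intro t
    induction t with
    | zero => exact ⟨0, map_zero _⟩
    | add x y hx hy =>
      obtain ⟨a, rfl⟩ := hx
      obtain ⟨b, rfl⟩ := hy
      exact ⟨a + b, map_add _ _ _⟩
    | tmul w q =>
      obtain ⟨y, hy⟩ := WittVector.mul_p_pow_mem_range_map p A e h w
      have hp : (p : ℚ) ^ e ≠ 0 := pow_ne_zero _ (Nat.cast_ne_zero.2 (Fact.out : p.Prime).ne_zero)
      have hw : w * (p : WittVector p B) ^ e = ((p : ℤ) ^ e) • w := by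
        rw [zsmul_eq_mul, mul_comm]
        push_cast
        rfl
      have hq : ((p : ℤ) ^ e) • (q / (p : ℚ) ^ e) = q := by
        rw [zsmul_eq_mul]
        push_cast
        exact mul_div_cancel₀ q hp
      refine ⟨y ⊗ₜ[ℤ] (q / (p : ℚ) ^ e), ?_⟩
      change WittVector.map A.subtype y ⊗ₜ[ℤ] (q / (p : ℚ) ^ e) = w ⊗ₜ[ℤ] q
      rw [hy, hw, TensorProduct.smul_tmul, hq]
end

section
/- Let p be a prime number, let K and L be perfect fields of characteristic p, and let ι : K → L be a ring homomorphism. If the induced ring homomorphism W(K) ⊗_ℤ ℚ → W(L) ⊗_ℤ ℚ is surjective, then ι is surjective, i.e., ι is an isomorphism of fields. (This is the field-theoretic core of the lemma that a finite morphism of zero-dimensional schemes inducing an isomorphism on rational 0-th Witt vector cohomology is a universal homeomorphism.) -/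
open scoped TensorProduct

/-- The ring of Witt vectors over a domain of characteristic `p` has characteristic zero. -/
theorem WittVector.charZero_of_charP (p : ℕ) [Fact p.Prime] (L : Type*) [CommRing L] [IsDomain L]
    [CharP L p] : CharZero (WittVector p L) := by
  refine charZero_of_inj_zero fun n hn => ?_
  by_contra hn0
  obtain ⟨k, m, hm, rfl⟩ := Nat.exists_eq_pow_mul_and_not_dvd hn0 p (Fact.out : p.Prime).ne_one
  rw [Nat.cast_mul, Nat.cast_pow, mul_eq_zero] at hn
  rcases hn with hn | hn
  · exact WittVector.p_nonzero p L (eq_zero_of_pow_eq_zero hn)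
  · apply hm
    rw [← CharP.cast_eq_zero_iff L p]
    have := congrArg (WittVector.constantCoeff (p := p)) hn
    simpa using this

/-- Over a torsion-free abelian group, `x ↦ x ⊗ 1` into the rationalization is injective. -/
theorem TensorProduct.tmul_one_rat_injective (M : Type*) [AddCommGroup M] [Module.Flat ℤ M] :
    Function.Injective fun x : M => x ⊗ₜ[ℤ] (1 : ℚ) := by
  have h := Module.Flat.lTensor_preserves_injective_linearMap (M := M)
    (Algebra.linearMap ℤ ℚ) (by intro a b hab; simpa using hab)
  intro x y hxy
  apply (TensorProduct.rid ℤ M).symm.injective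
  apply h
  simpa using hxy

/-- Every element of a rationalization has a nonzero multiple of the form `x ⊗ 1`. -/
theorem TensorProduct.exists_nsmul_eq_tmul_one_rat (M : Type*) [AddCommGroup M] (z : M ⊗[ℤ] ℚ) :
    ∃ n : ℕ, n ≠ 0 ∧ ∃ x : M, n • z = x ⊗ₜ[ℤ] (1 : ℚ) := by
  induction z with
  | zero => exact ⟨1, one_ne_zero, 0, by simp⟩
  | tmul x q =>
    refine ⟨q.den, q.den_nz, q.num • x, ?_⟩
    rw [← TensorProduct.tmul_smul, TensorProduct.smul_tmul]
    congr 1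
    simp [mul_comm]
  | add a b ha hb =>
    obtain ⟨m, hm, x, hx⟩ := ha
    obtain ⟨n, hn, y, hy⟩ := hb
    refine ⟨m * n, mul_ne_zero hm hn, n • x + m • y, ?_⟩
    rw [smul_add, mul_comm m n, mul_smul, hx, mul_comm n m, mul_smul, hy, TensorProduct.add_tmul,
      TensorProduct.smul_tmul', TensorProduct.smul_tmul']

/-- Let `p` be a prime, `K`, `L` perfect fields of characteristic `p`, `ι : K → L` a ring
homomorphism.  If the induced ring homomorphism `W(K) ⊗[ℤ] ℚ → W(L) ⊗[ℤ] ℚ` is surjective,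
then `ι` is surjective (hence an isomorphism of fields). -/
theorem surjective_of_witt_tensor_rat_surjective
    (p : ℕ) [Fact p.Prime] (K L : Type*) [Field K] [Field L]
    [CharP K p] [CharP L p] [PerfectRing K p] [PerfectRing L p]
    (ι : K →+* L)
    (h : Function.Surjective
      (Algebra.TensorProduct.map (WittVector.map ι).toIntAlgHom (AlgHom.id ℤ ℚ) :
        WittVector p K ⊗[ℤ] ℚ →ₐ[ℤ] WittVector p L ⊗[ℤ] ℚ)) :
    Function.Surjective ι := by
  intro l
  have := WittVector.charZero_of_charP p L
  obtain ⟨z, hz⟩ := h (WittVector.teichmuller p l ⊗ₜ 1)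
  obtain ⟨n, hn, w, hw⟩ := TensorProduct.exists_nsmul_eq_tmul_one_rat _ z
  have key : n • WittVector.teichmuller p l = WittVector.map ι w := by
    apply TensorProduct.tmul_one_rat_injective
    have := congrArg (Algebra.TensorProduct.map (WittVector.map (p := p) ι).toIntAlgHom
      (AlgHom.id ℤ ℚ)) hw
    rw [map_nsmul, hz] at this
    simpa [TensorProduct.smul_tmul'] using this
  obtain ⟨k, m, hm, rfl⟩ := Nat.exists_eq_pow_mul_and_not_dvd hn p (Fact.out : p.Prime).ne_one
  have hmK : (m : K) ≠ 0 := by rwa [Ne, CharP.cast_eq_zero_iff K p]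
  have hmL : (m : L) ≠ 0 := by rwa [Ne, CharP.cast_eq_zero_iff L p]
  obtain ⟨v, hv⟩ := (bijective_iterateFrobenius K p (n := k)).2 (w.coeff k)
  have hc := WittVector.mul_pow_charP_coeff_succ
    ((m : WittVector p L) * WittVector.teichmuller p l) (m := 0) (n := k)
  have h0 : ((m : WittVector p L) * WittVector.teichmuller p l).coeff 0 = m * l := by
    rw [WittVector.mul_coeff_zero, WittVector.teichmuller_coeff_zero]
    congr 1
    exact map_natCast (WittVector.constantCoeff (p := p) (R := L)) m
  have e : (m : WittVector p L) * WittVector.teichmuller p l * (p : WittVector p L) ^ k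
      = WittVector.map ι w := by
    rw [← key, nsmul_eq_mul]; push_cast; ring
  rw [e, zero_add, WittVector.map_coeff, h0, ← hv, iterateFrobenius_def, map_pow] at hc
  have hml : ι v = m * l := (bijective_iterateFrobenius L p (n := k)).1 (by
    simpa only [iterateFrobenius_def] using hc)
  exact ⟨v / m, by rw [map_div₀, map_natCast, hml, mul_div_cancel_left₀ _ hmL]⟩
end
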